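/- Let G be a finite multigraph with a linear order on its edges and t ≥ 1 an integer. Then, as an identity of rational functions in y, T_Ĝ(1 + 1/y, y) = Σ_F y^{ω(F) + t·act_G(F) − v(G) + c(G)}, where the sum ranges over all t-labeled forests F of G. -/

import Mathlib

open MvPolynomial

namespace ForestAlg

variable {V E : Type*}

/-- Two vertices are directly connected by an edge of `A`. -/
def edgeRel (ends : E → Sym2 V) (A : Finset E) (v w : V) : Prop :=
  ∃ e ∈ A, ends e = s(v, w)

/-- Number of connected components of the spanning subgraph `(V, A)`. -/
noncomputable def numComponents (ends : E → Sym2 V) (A : Finset E) : ℕ :=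
  Nat.card (Quot (edgeRel ends A))

/-- Rank `r(A) = v(G) - c(V,A)`. -/
noncomputable def rank (ends : E → Sym2 V) (A : Finset E) : ℕ :=
  Nat.card V - numComponents ends A

/-- `A` is a subforest (contains no cycle): `|A| = v(G) - c(V,A)`. -/
def IsForest (ends : E → Sym2 V) (A : Finset E) : Prop :=
  A.card + numComponents ends A = Nat.card V

/-- The Tutte polynomial, evaluated at `(x, y)`. -/
noncomputable def tutte [Fintype E] {R : Type*} [CommRing R]
    (ends : E → Sym2 V) (x y : R) : R :=
  ∑ A ∈ (Finset.univ : Finset E).powerset,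
    (x - 1) ^ (rank ends Finset.univ - rank ends A) *
      (y - 1) ^ (A.card - rank ends A)

/-- `e ∉ F` is externally active for the subforest `F` with respect to the linear
order `o`: `F + e` contains a cycle and `e` is the minimal edge of that cycle
(the edges of the unique cycle of `F + e` are those whose removal does not
decrease the rank). -/
def ExtActive [DecidableEq E] (o : LinearOrder E) (ends : E → Sym2 V)
    (F : Finset E) (e : E) : Prop :=
  e ∉ F ∧ ¬ IsForest ends (insert e F) ∧
    ∀ f ∈ insert e F,
      rank ends ((insert e F).erase f) = rank ends (insert e F) → o.le e f

/-- External activity `act_G(F)`. -/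
noncomputable def act [DecidableEq E] (o : LinearOrder E) (ends : E → Sym2 V)
    (F : Finset E) : ℕ :=
  Set.ncard {e : E | ExtActive o ends F e}

/-- `D_I`: number of edges with one endpoint in `I` and the other outside `I`. -/
noncomputable def crossCount {n : ℕ} (ends : E → Sym2 (Fin n))
    (I : Finset (Fin n)) : ℕ :=
  Set.ncard {e : E | (∃ v ∈ ends e, v ∈ I) ∧ ∃ w ∈ ends e, w ∉ I}

/-- The ideal `J_G^{F_t}` generated by `(∑_{i ∈ I} x_i)^{t·D_I + 1}` over nonempty `I`. -/
noncomputable def forestIdeal (K : Type*) [Field K] {n : ℕ} (t : ℕ)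
    (ends : E → Sym2 (Fin n)) : Ideal (MvPolynomial (Fin n) K) :=
  Ideal.span {p | ∃ I : Finset (Fin n), I.Nonempty ∧
    p = (∑ i ∈ I, X i) ^ (t * crossCount ends I + 1)}

/-- The `k`-th graded component of `K[x_1,…,x_n]/J` (for homogeneous `J`):
the image of the degree-`k` homogeneous part in the quotient. -/
noncomputable def gradedPiece (K : Type*) [Field K] {n : ℕ}
    (J : Ideal (MvPolynomial (Fin n) K)) (k : ℕ) :
    Submodule K (MvPolynomial (Fin n) K ⧸ J) :=
  Submodule.map (Ideal.Quotient.mkₐ K J).toLinearMap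
    (homogeneousSubmodule (Fin n) K k)

/-- Dimension of the `k`-th graded component of the quotient. -/
noncomputable def gradedDim (K : Type*) [Field K] {n : ℕ}
    (J : Ideal (MvPolynomial (Fin n) K)) (k : ℕ) : ℕ :=
  Module.finrank K (gradedPiece K J k)


/-- The partition of the vertices into the connected components of `(V, A)`. -/
def conn (ends : E → Sym2 V) (A : Finset E) : Setoid V :=
  Setoid.ker (Quot.mk (edgeRel ends A))

theorem conn_le_iff {ends : E → Sym2 V} {A : Finset E} {s : Setoid V} :
    conn ends A ≤ s ↔ ∀ e ∈ A, ∀ v w, ends e = s(v, w) → s v w := by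
  constructor
  · intro h e he v w hvw
    exact h (Quot.sound ⟨e, he, hvw⟩)
  · intro h v w hvw
    have hlift : ∀ x y, edgeRel ends A x y → (Quotient.mk s x) = Quotient.mk s y := by
      rintro x y ⟨e, he, hxy⟩
      exact Quotient.sound (h e he x y hxy)
    exact Quotient.exact (congrArg (Quot.lift (Quotient.mk s) hlift) hvw)

theorem conn_singleton_le_iff {ends : E → Sym2 V} {e : E} {s : Setoid V} :
    conn ends {e} ≤ s ↔ ∀ v w, ends e = s(v, w) → s v w := by
  simp [conn_le_iff]

theorem conn_le_iff_forall_singleton {ends : E → Sym2 V} {A : Finset E} {s : Setoid V} :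
    conn ends A ≤ s ↔ ∀ e ∈ A, conn ends {e} ≤ s := by
  simp [conn_le_iff]

theorem conn_mono {ends : E → Sym2 V} {A B : Finset E} (h : A ⊆ B) :
    conn ends A ≤ conn ends B :=
  conn_le_iff.2 fun e he => conn_le_iff.1 le_rfl e (h he)

theorem conn_insert [DecidableEq E] (ends : E → Sym2 V) (A : Finset E) (e : E) :
    conn ends (insert e A) = conn ends A ⊔ conn ends {e} := by
  apply le_antisymm
  · rw [conn_le_iff_forall_singleton]
    intro f hf
    rcases Finset.mem_insert.1 hf with rfl | hf
    · exact le_sup_right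
    · exact (conn_mono (by simpa using hf)).trans le_sup_left
  · exact sup_le (conn_mono (Finset.subset_insert _ _)) (conn_mono (by simp))

theorem numComponents_eq_card_quotient (ends : E → Sym2 V) (A : Finset E) :
    numComponents ends A = Nat.card (Quotient (conn ends A)) :=
  Nat.card_congr (Setoid.quotientKerEquivOfSurjective _ Quot.mk_surjective).symm

/-- The join of a partition with one edge, described explicitly. -/
theorem sup_conn_singleton_iff {ends : E → Sym2 V} {e : E} {a b : V} (he : ends e = s(a, b))
    (s : Setoid V) (x y : V) :
    (s ⊔ conn ends {e}) x y ↔ s x y ∨ (s x a ∧ s b y) ∨ (s x b ∧ s a y) := by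
  have hab : (s ⊔ conn ends {e}) a b :=
    conn_singleton_le_iff.1 (le_sup_right : _ ≤ s ⊔ conn ends {e}) a b he
  have hs : ∀ {u v}, s u v → (s ⊔ conn ends {e}) u v := fun h => (le_sup_left : s ≤ _) h
  constructor
  · let j : Setoid V :=
      { r := fun x y => s x y ∨ (s x a ∧ s b y) ∨ (s x b ∧ s a y)
        iseqv := by
          have hr : ∀ u, s u u := s.refl'
          have hsy : ∀ {u v}, s u v → s v u := s.symm'
          have ht : ∀ {u v w}, s u v → s v w → s u w := s.trans'
          refine ⟨fun u => Or.inl (hr u), ?_, ?_⟩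
          · rintro u v (h | ⟨h, h'⟩ | ⟨h, h'⟩)
            · exact Or.inl (hsy h)
            · exact Or.inr (Or.inr ⟨hsy h', hsy h⟩)
            · exact Or.inr (Or.inl ⟨hsy h', hsy h⟩)
          · rintro u v w (h | ⟨h, h'⟩ | ⟨h, h'⟩) (k | ⟨k, k'⟩ | ⟨k, k'⟩)
            · exact Or.inl (ht h k)
            · exact Or.inr (Or.inl ⟨ht h k, k'⟩)
            · exact Or.inr (Or.inr ⟨ht h k, k'⟩)
            · exact Or.inr (Or.inl ⟨h, ht h' k⟩)
            · exact Or.inr (Or.inl ⟨h, k'⟩)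
            · exact Or.inl (ht h k')
            · exact Or.inr (Or.inr ⟨h, ht h' k⟩)
            · exact Or.inl (ht h k')
            · exact Or.inr (Or.inr ⟨h, k'⟩) }
    have hle : s ⊔ conn ends {e} ≤ j := by
      refine sup_le (fun u v h => Or.inl h) (conn_singleton_le_iff.2 fun v w hvw => ?_)
      rw [he, Sym2.eq_iff] at hvw
      rcases hvw with ⟨rfl, rfl⟩ | ⟨rfl, rfl⟩
      · exact Or.inr (Or.inl ⟨s.refl' _, s.refl' _⟩)
      · exact Or.inr (Or.inr ⟨s.refl' _, s.refl' _⟩)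
    exact fun h => hle h
  · rintro (h | ⟨h, h'⟩ | ⟨h, h'⟩)
    · exact hs h
    · exact Setoid.trans' _ (hs h) (Setoid.trans' _ hab (hs h'))
    · exact Setoid.trans' _ (hs h) (Setoid.trans' _ (Setoid.symm' _ hab) (hs h'))

theorem conn_singleton_le_iff_of_ends {ends : E → Sym2 V} {e : E} {a b : V}
    (he : ends e = s(a, b)) {s : Setoid V} : conn ends {e} ≤ s ↔ s a b := by
  rw [conn_singleton_le_iff]
  refine ⟨fun h => h a b he, fun h v w hvw => ?_⟩
  rw [he, Sym2.eq_iff] at hvw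
  rcases hvw with ⟨rfl, rfl⟩ | ⟨rfl, rfl⟩
  · exact h
  · exact s.symm' h

/-- Exchange property of graphic closure. -/
theorem conn_singleton_exchange {ends : E → Sym2 V} {e f : E} {s : Setoid V}
    (h : conn ends {e} ≤ s ⊔ conn ends {f}) (hs : ¬ conn ends {e} ≤ s) :
    conn ends {f} ≤ s ⊔ conn ends {e} := by
  obtain ⟨a, b, he⟩ : ∃ a b, ends e = s(a, b) := by
    induction h : ends e with | _ a b => exact ⟨a, b, rfl⟩
  obtain ⟨c, d, hf⟩ : ∃ a b, ends f = s(a, b) := by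
    induction h : ends f with | _ a b => exact ⟨a, b, rfl⟩
  rw [conn_singleton_le_iff_of_ends he] at h hs
  rw [conn_singleton_le_iff_of_ends hf, sup_conn_singleton_iff he]
  rw [sup_conn_singleton_iff hf] at h
  rcases h with h | ⟨h, h'⟩ | ⟨h, h'⟩
  · exact absurd h hs
  · exact Or.inr (Or.inl ⟨s.symm' h, s.symm' h'⟩)
  · exact Or.inr (Or.inr ⟨h', h⟩)

theorem card_quotient_sup_conn_singleton [Finite V] {ends : E → Sym2 V} {e : E} {s : Setoid V}
    (hs : ¬ conn ends {e} ≤ s) :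
    Nat.card (Quotient (s ⊔ conn ends {e})) + 1 = Nat.card (Quotient s) := by
  obtain ⟨a, b, he⟩ : ∃ a b, ends e = s(a, b) := by
    induction h : ends e with | _ a b => exact ⟨a, b, rfl⟩
  rw [conn_singleton_le_iff_of_ends he] at hs
  let g : Quotient s → Quotient (s ⊔ conn ends {e}) :=
    Quotient.map' id fun _ _ h => (le_sup_left : s ≤ _) h
  have hg : Function.Bijective
      (fun q : {q : Quotient s // q ≠ Quotient.mk s b} => g q.1) := by
    constructor
    · rintro ⟨x, hx⟩ ⟨y, hy⟩ hxy
      induction x using Quotient.inductionOn with | _ x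
      induction y using Quotient.inductionOn with | _ y
      have h := (sup_conn_singleton_iff he s x y).1 (Quotient.exact hxy)
      rcases h with h | ⟨-, h⟩ | ⟨h, -⟩
      · exact Subtype.ext (Quotient.sound h)
      · exact absurd (Quotient.sound (s.symm' h)) hy
      · exact absurd (Quotient.sound h) hx
    · intro y
      induction y using Quotient.inductionOn with | _ y
      by_cases hy : s y b
      · refine ⟨⟨Quotient.mk s a, fun h => hs (Quotient.exact h)⟩, Quotient.sound ?_⟩
        exact (sup_conn_singleton_iff he s a y).2 (Or.inr (Or.inl ⟨s.refl' a, s.symm' hy⟩))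
      · exact ⟨⟨Quotient.mk s y, fun h => hy (Quotient.exact h)⟩, rfl⟩
  rw [← Nat.card_congr (Equiv.ofBijective _ hg)]
  have := Set.ncard_add_ncard_compl {Quotient.mk s b}
  rw [Set.ncard_singleton] at this
  rw [← this, add_comm]
  rfl

theorem numComponents_le [Finite V] (ends : E → Sym2 V) (A : Finset E) :
    numComponents ends A ≤ Nat.card V :=
  Nat.card_le_card_of_surjective _ Quot.mk_surjective

theorem rank_eq_of_conn_eq {E' : Type*} {ends : E → Sym2 V} {ends' : E' → Sym2 V}
    {A : Finset E} {B : Finset E'} (h : conn ends A = conn ends' B) :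
    rank ends A = rank ends' B := by
  simp only [rank, numComponents_eq_card_quotient, h]

theorem rank_insert_of_le [DecidableEq E] {ends : E → Sym2 V} {A : Finset E} {e : E}
    (h : conn ends {e} ≤ conn ends A) : rank ends (insert e A) = rank ends A :=
  rank_eq_of_conn_eq (by rw [conn_insert, sup_eq_left.2 h])

theorem rank_insert_of_not_le [Finite V] [DecidableEq E] {ends : E → Sym2 V} {A : Finset E}
    {e : E} (h : ¬ conn ends {e} ≤ conn ends A) :
    rank ends (insert e A) = rank ends A + 1 := by
  have h1 := card_quotient_sup_conn_singleton h
  rw [← conn_insert, ← numComponents_eq_card_quotient, ← numComponents_eq_card_quotient] at h1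
  have := numComponents_le ends A
  simp only [rank]
  omega

theorem rank_empty (ends : E → Sym2 V) : rank ends ∅ = 0 := by
  have h : conn ends ∅ = ⊥ := by
    rw [eq_bot_iff, conn_le_iff]; simp
  rw [rank, numComponents_eq_card_quotient, h,
    ← Nat.card_congr (Equiv.ofBijective (Quotient.mk (⊥ : Setoid V))
      ⟨fun _ _ h => Quotient.exact h, Quotient.mk_surjective⟩), Nat.sub_self]

theorem rank_le_card [Finite V] (ends : E → Sym2 V) (A : Finset E) :
    rank ends A ≤ A.card := by
  classical
  induction A using Finset.induction_on with
  | empty => simp [rank_empty]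
  | insert e A he ih =>
    rw [Finset.card_insert_of_notMem he]
    by_cases h : conn ends {e} ≤ conn ends A
    · rw [rank_insert_of_le h]; omega
    · rw [rank_insert_of_not_le h]; omega

theorem isForest_iff_rank [Finite V] {ends : E → Sym2 V} {A : Finset E} :
    IsForest ends A ↔ rank ends A = A.card := by
  have := numComponents_le ends A
  simp only [IsForest, rank]
  omega

theorem isForest_insert_iff [Finite V] [DecidableEq E] {ends : E → Sym2 V} {A : Finset E} {e : E}
    (he : e ∉ A) :
    IsForest ends (insert e A) ↔ IsForest ends A ∧ ¬ conn ends {e} ≤ conn ends A := by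
  rw [isForest_iff_rank, isForest_iff_rank, Finset.card_insert_of_notMem he]
  have := rank_le_card ends A
  by_cases h : conn ends {e} ≤ conn ends A
  · rw [rank_insert_of_le h]; simp only [h, not_true_eq_false, and_false, iff_false]; omega
  · rw [rank_insert_of_not_le h]; simp only [h, not_false_eq_true, and_true]; omega

theorem isForest_erase_iff [Finite V] [DecidableEq E] {ends : E → Sym2 V} {A : Finset E} {e : E}
    (he : e ∈ A) :
    IsForest ends A ↔ IsForest ends (A.erase e) ∧ ¬ conn ends {e} ≤ conn ends (A.erase e) := by
  rw [← isForest_insert_iff (Finset.notMem_erase e A), Finset.insert_erase he]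

/-- In a forest, an edge spanned by every `F - f` with `f ∈ B` is spanned by `F ∖ B`. -/
theorem conn_singleton_le_sdiff [Finite V] [DecidableEq E] {ends : E → Sym2 V} {F : Finset E}
    {e : E} (hF : IsForest ends F) (he : conn ends {e} ≤ conn ends F) (B : Finset E)
    (hBF : B ⊆ F) (hB : ∀ f ∈ B, conn ends {e} ≤ conn ends (F.erase f)) :
    conn ends {e} ≤ conn ends (F \ B) := by
  induction B using Finset.induction_on with
  | empty => simpa using he
  | insert f B hf ih =>
    have hfF : f ∈ F := hBF (Finset.mem_insert_self f B)
    have ih' := ih (fun x hx => hBF (Finset.mem_insert_of_mem hx))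
      fun x hx => hB x (Finset.mem_insert_of_mem hx)
    have hins : insert f (F \ insert f B) = F \ B := by
      ext x
      simp only [Finset.mem_insert, Finset.mem_sdiff]
      by_cases hx : x = f
      · subst hx; simp [hfF, hf]
      · simp [hx]
    rw [← hins, conn_insert] at ih'
    by_contra hcon
    refine ((isForest_erase_iff hfF).1 hF).2 ((conn_singleton_exchange ih' hcon).trans ?_)
    refine sup_le (conn_mono fun x hx => ?_) (hB f (Finset.mem_insert_self f B))
    simp only [Finset.mem_sdiff, Finset.mem_insert, not_or] at hx
    exact Finset.mem_erase.2 ⟨hx.2.1, hx.1⟩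

theorem extActive_iff [Finite V] [o : LinearOrder E] {ends : E → Sym2 V} {F : Finset E}
    (hF : IsForest ends F) (e : E) :
    ExtActive o ends F e ↔ e ∉ F ∧ conn ends {e} ≤ conn ends {f ∈ F | e < f} := by
  refine and_congr_right fun heF => ?_
  rw [isForest_insert_iff heF]
  simp only [hF, true_and, not_not]
  have herase : ∀ f ∈ F, (insert e F).erase f = insert e (F.erase f) := fun f hf =>
    Finset.erase_insert_of_ne (by rintro rfl; exact heF hf)
  have hrank : ∀ f ∈ F, conn ends {e} ≤ conn ends F →
      (rank ends ((insert e F).erase f) = rank ends (insert e F) ↔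
        ¬ conn ends {e} ≤ conn ends (F.erase f)) := by
    intro f hf he
    have h1 := isForest_iff_rank.1 hF
    have h2 := isForest_iff_rank.1 ((isForest_erase_iff hf).1 hF).1
    have h3 := Finset.card_erase_add_one hf
    rw [herase f hf, rank_insert_of_le he]
    by_cases h : conn ends {e} ≤ conn ends (F.erase f)
    · rw [rank_insert_of_le h]; simp only [h, not_true_eq_false, iff_false]; omega
    · rw [rank_insert_of_not_le h]; simp only [h, not_false_eq_true, iff_true]; omega
  constructor
  · rintro ⟨he, h⟩
    have := conn_singleton_le_sdiff hF he {f ∈ F | ¬ e < f} (Finset.filter_subset _ _) (by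
      intro f hf
      obtain ⟨hf, hef⟩ := Finset.mem_filter.1 hf
      by_contra hcon
      have hle : e ≤ f := h f (Finset.mem_insert_of_mem hf) ((hrank f hf he).2 hcon)
      exact hef (lt_of_le_of_ne hle (by rintro rfl; exact heF hf)))
    refine this.trans (conn_mono fun x hx => ?_)
    simp only [Finset.mem_sdiff, Finset.mem_filter, not_and, not_not] at hx ⊢
    exact ⟨hx.1, hx.2 hx.1⟩
  · intro h
    have he := h.trans (conn_mono (Finset.filter_subset _ _))
    refine ⟨he, fun f hf hr => ?_⟩
    rcases Finset.mem_insert.1 hf with rfl | hf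
    · exact le_refl f
    · by_contra hcon
      refine (hrank f hf he).1 hr (h.trans (conn_mono fun x hx => ?_))
      obtain ⟨hx, hex⟩ := Finset.mem_filter.1 hx
      exact Finset.mem_erase.2 ⟨by rintro rfl; exact hcon hex.le, hx⟩

open scoped Classical in
theorem act_eq_card [Finite V] [Fintype E] [o : LinearOrder E] {ends : E → Sym2 V} {F : Finset E}
    (hF : IsForest ends F) :
    act o ends F =
      ({e | e ∉ F ∧ conn ends {e} ≤ conn ends {f ∈ F | e < f}} : Finset E).card := by
  rw [act, ← Set.ncard_coe_finset]
  congr 1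
  ext e
  simp [extActive_iff hF]

open scoped Classical in
/-- Subset expansion equals forest expansion, weighted by an arbitrary function of the
partition into components. -/
theorem sum_subsets_eq_sum_forests [Finite V] [LinearOrder E] {R : Type*} [CommRing R]
    (ends : E → Sym2 V) (a z : R) (S : Finset E) (φ : Setoid V → R) :
    ∑ A ∈ S.powerset, a ^ rank ends A * (z - 1) ^ (A.card - rank ends A) * φ (conn ends A) =
      ∑ A ∈ S.powerset, if IsForest ends A then
        a ^ A.card *
          z ^ ({e ∈ S | e ∉ A ∧ conn ends {e} ≤ conn ends {f ∈ A | e < f}} : Finset E).card *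
          φ (conn ends A) else 0 := by
  induction S using Finset.induction_on_min generalizing φ with
  | empty => simp [rank_empty, isForest_iff_rank]
  | insert m S hm ih =>
    have hmS : m ∉ S := fun h => lt_irrefl _ (hm m h)
    rw [Finset.sum_powerset_insert hmS, Finset.sum_powerset_insert hmS,
      ← Finset.sum_add_distrib, ← Finset.sum_add_distrib]
    have key := ih fun s => if conn ends {m} ≤ s then z * φ s
      else φ s + a * φ (s ⊔ conn ends {m})
    refine Eq.trans (Finset.sum_congr rfl fun A hA => ?_)
      (key.trans (Finset.sum_congr rfl fun A hA => ?_))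
    · have hmA : m ∉ A := fun h => hmS (Finset.mem_powerset.1 hA h)
      have hr := rank_le_card ends A
      rw [conn_insert, Finset.card_insert_of_notMem hmA]
      split_ifs with h
      · rw [rank_insert_of_le h, sup_eq_left.2 h, Nat.sub_add_comm hr]
        ring
      · rw [rank_insert_of_not_le h, Nat.add_sub_add_right]
        ring
    · have hAS := Finset.mem_powerset.1 hA
      have hmA : m ∉ A := fun h => hmS (hAS h)
      have hfm : {f ∈ A | m < f} = A :=
        Finset.filter_true_of_mem fun f hf => hm f (hAS hf)
      have hins : ({e ∈ insert m S | e ∉ insert m A ∧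
          conn ends {e} ≤ conn ends {f ∈ insert m A | e < f}} : Finset E) =
          {e ∈ S | e ∉ A ∧ conn ends {e} ≤ conn ends {f ∈ A | e < f}} := by
        ext e
        simp only [Finset.mem_filter, Finset.mem_insert]
        by_cases hem : e = m
        · subst hem; simp [hmS]
        · simp only [hem, false_or]
          refine and_congr_right fun he => ?_
          rw [Finset.filter_insert, if_neg (hm e he).not_gt]
      rw [hins, isForest_insert_iff hmA, Finset.card_insert_of_notMem hmA, conn_insert,
        Finset.filter_insert, hfm]
      have hmf : m ∉ ({e ∈ S | e ∉ A ∧ conn ends {e} ≤ conn ends {f ∈ A | e < f}} : Finset E) :=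
        fun h => hmS (Finset.mem_filter.1 h).1
      by_cases hF : IsForest ends A <;> by_cases h : conn ends {m} ≤ conn ends A <;>
        simp [hF, h, hmA, hmS] <;> ring

/-- A finset of pairs is the same as a family of finsets of second coordinates. -/
def finsetProdEquiv (α β : Type*) [Fintype α] [Fintype β] [DecidableEq α] [DecidableEq β] :
    (α → Finset β) ≃ Finset (α × β) where
  toFun g := {p | p.2 ∈ g p.1}
  invFun S a := {b | (a, b) ∈ S}
  left_inv g := by ext; simp
  right_inv S := by ext; simp

theorem card_finsetProdEquiv {α β : Type*} [Fintype α] [Fintype β] [DecidableEq α]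
    [DecidableEq β] (g : α → Finset β) :
    (finsetProdEquiv α β g).card = ∑ a, (g a).card := by
  rw [← Finset.card_sigma]
  refine Finset.card_bij' (fun p _ => ⟨p.1, p.2⟩) (fun p _ => (p.1, p.2)) ?_ ?_ ?_ ?_ <;>
    simp [finsetProdEquiv]

theorem sum_pow_card_of_image_fst {α : Type*} [Fintype α] [DecidableEq α] {R : Type*}
    [CommRing R] (t : ℕ) (y : R) (A : Finset α) :
    ∑ S : Finset (α × Fin t) with S.image Prod.fst = A, (y - 1) ^ S.card =
      (y ^ t - 1) ^ A.card := by
  have hsum : ∑ B : Finset (Fin t), (y - 1) ^ B.card = y ^ t := by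
    have := Finset.sum_pow_mul_eq_add_pow (y - 1) 1 (Finset.univ : Finset (Fin t))
    simpa using this
  have hne : ∑ B : Finset (Fin t) with B.Nonempty, (y - 1) ^ B.card = y ^ t - 1 := by
    rw [← hsum, ← Finset.sum_filter_add_sum_filter_not Finset.univ
      (fun B : Finset (Fin t) => B.Nonempty) fun B => (y - 1) ^ B.card]
    simp [Finset.not_nonempty_iff_eq_empty, Finset.filter_eq']
  have hprod : ∏ a : α, ∑ B ∈ (if a ∈ A then ({B | B.Nonempty} : Finset (Finset (Fin t)))
      else {∅}), (y - 1) ^ B.card = (y ^ t - 1) ^ A.card := by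
    have : ∀ a : α, ∑ B ∈ (if a ∈ A then ({B | B.Nonempty} : Finset (Finset (Fin t)))
        else {∅}), (y - 1) ^ B.card = if a ∈ A then y ^ t - 1 else 1 := by
      intro a
      split_ifs
      · exact hne
      · simp
    simp [this]
  rw [← hprod, Finset.prod_univ_sum]
  symm
  refine Finset.sum_equiv (finsetProdEquiv α (Fin t)) (fun g => ?_) fun g _ => ?_
  · simp only [Fintype.mem_piFinset, Finset.mem_filter, Finset.mem_univ, true_and,
      Finset.ext_iff (s₂ := A)]
    refine forall_congr' fun a => ?_
    have : a ∈ (finsetProdEquiv α (Fin t) g).image Prod.fst ↔ (g a).Nonempty := by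
      simp [finsetProdEquiv, Finset.Nonempty]
    rw [this]
    by_cases ha : a ∈ A <;> simp [ha, Finset.not_nonempty_iff_eq_empty]
  · rw [card_finsetProdEquiv, Finset.prod_pow_eq_pow_sum]

theorem conn_image_fst [DecidableEq E] {ι : Type*} (ends : E → Sym2 V) (S : Finset (E × ι)) :
    conn (fun p : E × ι => ends p.1) S = conn ends (S.image Prod.fst) := by
  apply le_antisymm
  · exact conn_le_iff.2 fun p hp =>
      conn_le_iff.1 le_rfl p.1 (Finset.mem_image_of_mem Prod.fst hp)
  · refine conn_le_iff.2 fun e he => ?_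
    obtain ⟨p, hp, rfl⟩ := Finset.mem_image.1 he
    exact conn_le_iff.1 (le_refl (conn (fun p : E × ι => ends p.1) S)) p hp

/-- The sum of the monomials of all labellings of a set of edges. -/
theorem sum_labellings [DecidableEq E] {K : Type*} [Field K] (t : ℕ) (y : K) (A : Finset E) :
    ∑ ℓ : {x // x ∈ A} → Fin t, y ^ (∑ e : {x // x ∈ A}, ((ℓ e : ℕ) + 1)) =
      (y * ∑ i ∈ Finset.range t, y ^ i) ^ A.card := by
  have h := Finset.prod_univ_sum (fun _ : {x // x ∈ A} => (Finset.univ : Finset (Fin t)))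
    fun _ i => y ^ ((i : ℕ) + 1)
  rw [Fintype.piFinset_univ] at h
  simp only [Finset.prod_pow_eq_pow_sum] at h
  rw [← h, Finset.prod_const, Finset.card_univ, Fintype.card_coe, Finset.mul_sum,
    Fin.sum_univ_eq_sum_range fun i => y ^ (i + 1)]
  simp only [pow_succ']

theorem rank_mono [Finite V] {ends : E → Sym2 V} {A B : Finset E} (h : A ⊆ B) :
    rank ends A ≤ rank ends B := by
  refine Nat.sub_le_sub_left ?_ _
  rw [numComponents_eq_card_quotient, numComponents_eq_card_quotient]
  refine Nat.card_le_card_of_surjective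
    (Quotient.map' id fun _ _ hxy => conn_mono h hxy) fun q => ?_
  induction q using Quotient.inductionOn with | _ x
  exact ⟨Quotient.mk _ x, rfl⟩

/-- The Tutte polynomial of the `t`-fold multiplication of the edges, at `x = 1 + 1/y`. -/
theorem tutte_hat_eq_sum_subsets [Finite V] [Fintype E] [DecidableEq E] {K : Type*} [Field K]
    (t : ℕ) (ht : 1 ≤ t) (ends : E → Sym2 V) {y : K} (hy : y ≠ 0) (hy1 : y - 1 ≠ 0) :
    tutte (fun p : E × Fin t => ends p.1) (1 + 1 / y) y =
      ∑ A : Finset E, (y ^ rank ends Finset.univ)⁻¹ *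
        ((y * ∑ i ∈ Finset.range t, y ^ i) ^ rank ends A *
          (y ^ t - 1) ^ (A.card - rank ends A)) := by
  have hrank (S : Finset (E × Fin t)) :
      rank (fun p : E × Fin t => ends p.1) S = rank ends (S.image Prod.fst) :=
    rank_eq_of_conn_eq (conn_image_fst ends S)
  have huniv : (Finset.univ : Finset (E × Fin t)).image Prod.fst = Finset.univ := by
    ext e
    simpa using ⟨(⟨0, ht⟩ : Fin t)⟩
  rw [tutte, Finset.powerset_univ,
    ← Finset.sum_fiberwise Finset.univ fun S : Finset (E × Fin t) => S.image Prod.fst]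
  refine Finset.sum_congr rfl fun A _ => ?_
  have hA := rank_mono (ends := ends) (Finset.subset_univ A)
  have hcard := rank_le_card ends A
  have hterm : ∀ S ∈ ({S | S.image Prod.fst = A} : Finset (Finset (E × Fin t))),
      (1 + 1 / y - 1) ^ (rank (fun p : E × Fin t => ends p.1) Finset.univ -
          rank (fun p : E × Fin t => ends p.1) S) *
        (y - 1) ^ (S.card - rank (fun p : E × Fin t => ends p.1) S) =
      (y ^ rank ends Finset.univ)⁻¹ * y ^ rank ends A * ((y - 1) ^ rank ends A)⁻¹ *
        (y - 1) ^ S.card := by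
    intro S hS
    have hS' := (Finset.mem_filter.1 hS).2
    have hle := rank_le_card (fun p : E × Fin t => ends p.1) S
    rw [hrank, hS'] at hle
    rw [hrank, hrank, hS', huniv, add_sub_cancel_left, one_div, pow_sub₀ _ (inv_ne_zero hy) hA,
      pow_sub₀ _ hy1 hle]
    simp only [inv_pow, inv_inv]
    ring
  rw [Finset.sum_congr rfl hterm, ← Finset.mul_sum, sum_pow_card_of_image_fst]
  have hgeom : y ^ t - 1 = (∑ i ∈ Finset.range t, y ^ i) * (y - 1) := (geom_sum_mul y t).symm
  conv_lhs => rw [← Nat.sub_add_cancel hcard, pow_add]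
  rw [hgeom, mul_pow _ _ (rank ends A), mul_pow y]
  field_simp

open scoped Classical in
/-- Let `G` be a finite multigraph with a linear order `o` on
its edges and `t ≥ 1`. As an identity of rational functions in `y` (elements of
`RatFunc ℚ` with `y = X`),
`T_Ĝ(1 + 1/y, y) = Σ_F y^{ω(F) + t·act_G(F) - v(G) + c(G)}`, the sum ranging
over all `t`-labeled forests `F` of `G` (a labelling is a function
`ℓ : A → Fin t`, edge `e` carrying the label `ℓ e + 1 ∈ {1,…,t}`). -/
theorem tutte_hat_eq_sum_labeledForests {U E : Type} [Finite U] [Fintype E]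
    [DecidableEq E] (o : LinearOrder E) (t : ℕ) (ht : 1 ≤ t)
    (ends : E → Sym2 U) :
    tutte (V := U) (fun p : E × Fin t => ends p.1)
        (1 + 1 / RatFunc.X) (RatFunc.X : RatFunc ℚ)
      = ∑ A ∈ (Finset.univ : Finset E).powerset,
          if IsForest ends A then
            ∑ ℓ : {x // x ∈ A} → Fin t,
              (RatFunc.X : RatFunc ℚ) ^
                (((∑ e : {x // x ∈ A}, ((ℓ e : ℕ) + 1)
                    + t * act o ends A : ℕ) : ℤ)
                  - (Nat.card U : ℤ) + (numComponents ends Finset.univ : ℤ))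
          else 0 := by
  have hX : (RatFunc.X : RatFunc ℚ) ≠ 0 := RatFunc.X_ne_zero
  have hX1 : (RatFunc.X : RatFunc ℚ) - 1 ≠ 0 := by
    rw [← RatFunc.algebraMap_X, ← map_one (algebraMap (Polynomial ℚ) (RatFunc ℚ)), ← map_sub]
    exact RatFunc.algebraMap_ne_zero (by simpa using Polynomial.X_sub_C_ne_zero (1 : ℚ))
  obtain rfl : ‹DecidableEq E› = o.toDecidableEq := Subsingleton.elim _ _
  rw [tutte_hat_eq_sum_subsets t ht ends hX hX1, ← Finset.mul_sum, Finset.powerset_univ]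
  have key := sum_subsets_eq_sum_forests ends
    ((RatFunc.X : RatFunc ℚ) * ∑ i ∈ Finset.range t, RatFunc.X ^ i) (RatFunc.X ^ t)
    Finset.univ fun _ => 1
  simp only [mul_one, Finset.powerset_univ] at key
  rw [key, Finset.mul_sum]
  refine Finset.sum_congr rfl fun A _ => ?_
  split_ifs with hF
  · rw [← act_eq_card hF, ← sum_labellings, Finset.sum_mul, Finset.mul_sum]
    refine Finset.sum_congr rfl fun ℓ _ => ?_
    have hexp (n : ℕ) : (n : ℤ) - (Nat.card U : ℤ) + (numComponents ends Finset.univ : ℤ) =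
        (n : ℤ) - (rank ends Finset.univ : ℤ) := by
      rw [rank, Nat.cast_sub (numComponents_le _ _)]
      ring
    rw [hexp, zpow_sub₀ hX, zpow_natCast, zpow_natCast, pow_add, pow_mul, div_eq_mul_inv]
    ring
  · rw [mul_zero]

end ForestAlg
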